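/- The Lie algebra 𝔤₃ = {T(a,b) | a ∈ ℝ ⊕ ℝi, b ∈ ℍ, Re b = 0} is a Berger algebra: the endomorphisms R(u, v), for R an algebraic curvature tensor of type 𝔤₃ and u, v ∈ V, span 𝔤₃ over ℝ. -/

import Mathlib

open Quaternion

noncomputable section

/-- `V = ℍ × ℍ`, the pseudo-quaternionic-Hermitian space `ℍ^{1,1}` in an isotropic basis
`p = (1,0)`, `q = (0,1)`. -/
abbrev V : Type := ℍ[ℝ] × ℍ[ℝ]

/-- The neutral-signature metric `η((x,y),(x',y')) = Re(x conj(y') + y conj(x'))`. -/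
def η (u v : V) : ℝ := (u.1 * star v.2 + u.2 * star v.1).re

/-- The endomorphism of `ℍ^{1,1}` with matrix `[[a, b], [0, -conj a]]` in the isotropic
basis `(p, q)`: `T(a,b)(x,y) = (x a + y b, − y conj(a))`. -/
def T (a b : ℍ[ℝ]) : Module.End ℝ V where
  toFun u := (u.1 * a + u.2 * b, -(u.2 * star a))
  map_add' u v := by
    simp only [Prod.fst_add, Prod.snd_add, add_mul, Prod.mk_add_mk, Prod.mk.injEq]
    constructor <;> abel
  map_smul' r u := by
    simp only [Prod.smul_fst, Prod.smul_snd, RingHom.id_apply, Prod.smul_mk,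
      smul_mul_assoc, smul_add, smul_neg]

/-- `R` is an algebraic curvature tensor of type `g`: a bilinear alternating map
`V × V → End_ℝ(V)` with values in `g` satisfying the first Bianchi identity. -/
def IsCurv (g : Set (Module.End ℝ V)) (R : V →ₗ[ℝ] V →ₗ[ℝ] Module.End ℝ V) : Prop :=
  (∀ u v : V, R u v = - R v u) ∧ (∀ u v : V, R u v ∈ g) ∧
  (∀ u v w : V, R u v w + R v w u + R w u v = 0)

/-- The Lie algebra `𝔤₃ = {T(a,b) | a ∈ ℝ ⊕ ℝi, b ∈ Im ℍ}`. -/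
def g : Set (Module.End ℝ V) :=
  {f | ∃ a b : ℍ[ℝ], a.imJ = 0 ∧ a.imK = 0 ∧ b.re = 0 ∧ f = T a b}

/-- `T a b` depends additively on `(a, b)`. -/
theorem T_add (a a' b b' : ℍ[ℝ]) : T (a + a') (b + b') = T a b + T a' b' := by
  refine LinearMap.ext fun u => ?_
  simp only [T, LinearMap.coe_mk, AddHom.coe_mk, LinearMap.add_apply, Prod.mk_add_mk, mul_add,
    star_add, neg_add, Prod.mk.injEq, and_true]
  abel

/-- `T a b` depends homogeneously on `(a, b)`. -/
theorem T_smul (r : ℝ) (a b : ℍ[ℝ]) : T (r • a) (r • b) = r • T a b := by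
  refine LinearMap.ext fun u => ?_
  simp [T]

/-- The `a`-component of the curvature tensor `curv s t r`. -/
@[simps]
def curvA (s t : ℝ) (u v : V) : ℍ[ℝ] :=
  ⟨s * (star u.2 * v.2).imJ - t * (star u.2 * v.2).imK,
    s * (star u.2 * v.2).imK + t * (star u.2 * v.2).imJ, 0, 0⟩

/-- The `b`-component of the curvature tensor `curv s t r`. -/
@[simps]
def curvB (s t r : ℝ) (u v : V) : ℍ[ℝ] :=
  ⟨0, r * (star u.2 * v.2).imI,
    s * (star u.1 * v.2 - star v.1 * u.2).re + t * (star u.1 * v.2 - star v.1 * u.2).imI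
      - r * (star u.2 * v.2).imJ,
    s * (star u.1 * v.2 - star v.1 * u.2).imI - t * (star u.1 * v.2 - star v.1 * u.2).re⟩

/-- A three-parameter family of algebraic curvature tensors of type `g`. -/
def curv (s t r : ℝ) : V →ₗ[ℝ] V →ₗ[ℝ] Module.End ℝ V :=
  LinearMap.mk₂ ℝ (fun u v => T (curvA s t u v) (curvB s t r u v))
    (fun u u' v => by
      rw [← T_add]
      congr 1 <;> ext <;> simp <;> ring)
    (fun c u v => by
      rw [← T_smul]
      congr 1 <;> ext <;> simp <;> ring)
    (fun u v v' => by
      rw [← T_add]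
      congr 1 <;> ext <;> simp <;> ring)
    (fun c u v => by
      rw [← T_smul]
      congr 1 <;> ext <;> simp <;> ring)

theorem curv_apply (s t r : ℝ) (u v : V) :
    curv s t r u v = T (curvA s t u v) (curvB s t r u v) := rfl

theorem isCurv_curv (s t r : ℝ) : IsCurv g (curv s t r) := by
  refine ⟨fun u v => ?_, fun u v => ⟨_, _, rfl, rfl, rfl, curv_apply s t r u v⟩, fun u v w => ?_⟩
  · rw [curv_apply, curv_apply, ← neg_one_smul ℝ, ← T_smul]
    congr 1 <;> ext <;> simp <;> ring
  · simp only [curv_apply, T, LinearMap.coe_mk, AddHom.coe_mk, Prod.mk_add_mk, Prod.mk_eq_zero]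
    constructor <;> ext <;> simp <;> ring

/-- The quaternion with the given components. -/
@[simps]
def quat (x y z w : ℝ) : ℍ[ℝ] := ⟨x, y, z, w⟩

/-- Every `T a b` in `g` is a sum of three values of curvature tensors. -/
theorem T_eq_sum_curv {a b : ℍ[ℝ]} (haJ : a.imJ = 0) (haK : a.imK = 0) (hb : b.re = 0) :
    T a b = curv a.re a.imI 0 (0, 1) (0, quat 0 0 1 0)
      + curv 1 0 0 (1, 0) (0, quat b.imJ b.imK 0 0)
      + curv 0 0 b.imI (0, 1) (0, quat 0 1 0 0) := by
  simp only [curv_apply, ← T_add]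
  congr 1 <;> ext <;> simp [haJ, haK, hb]

/-- this Lie algebra is a Berger algebra: the endomorphisms `R u v`, for
`R` an algebraic curvature tensor of type the algebra and `u, v ∈ V`, span it over ℝ. -/
theorem g3_is_berger_algebra :
    Submodule.span ℝ {f : Module.End ℝ V |
        ∃ R : V →ₗ[ℝ] V →ₗ[ℝ] Module.End ℝ V, IsCurv g R ∧ ∃ u v : V, f = R u v}
      = Submodule.span ℝ g := by
  refine le_antisymm (Submodule.span_mono ?_) (Submodule.span_le.2 ?_)
  · rintro _ ⟨R, hR, u, v, rfl⟩
    exact hR.2.1 u v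
  · rintro _ ⟨a, b, haJ, haK, hb, rfl⟩
    rw [T_eq_sum_curv haJ haK hb]
    have mem (s t r : ℝ) (u v : V) : curv s t r u v ∈ Submodule.span ℝ {f : Module.End ℝ V |
        ∃ R : V →ₗ[ℝ] V →ₗ[ℝ] Module.End ℝ V, IsCurv g R ∧ ∃ u v : V, f = R u v} :=
      Submodule.subset_span ⟨curv s t r, isCurv_curv s t r, u, v, rfl⟩
    exact add_mem (add_mem (mem _ _ _ _ _) (mem _ _ _ _ _)) (mem _ _ _ _ _)

end
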